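/- arXiv:2602.14553 — 12 statements merged into one kernel-verified Lean document; each statement's English description precedes it below -/
import Mathlib

section
/- Fix m > 0. The function ε ↦ π(ε; m) on (0, ∞) attains its global maximum at the unique point ε*(m) = (m·G·η²·ε₀ + sqrt(m²·G²·η⁴·ε₀² + 4·G·η²·m·(G·η²·ε₀ + p·ε₀²))) / (2·m·(G·η² + p·ε₀)); that is, π(ε*(m); m) ≥ π(ε; m) for all ε > 0, with equality only when ε = ε*(m). -/
/-- If `s > 0` is a root of `m·B·s² = m·A·s + A`, then `ε ↦ (B - A / ε) · exp (-m·ε)` on `(0, ∞)`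
is strictly maximized at `s`. -/
lemma sub_div_mul_exp_neg_lt {A B m s ε : ℝ} (hA : 0 < A) (hm : 0 < m) (hs : 0 < s)
    (hroot : m * B * s ^ 2 = m * A * s + A) (hε : 0 < ε) (hne : ε ≠ s) :
    (B - A / ε) * Real.exp (-(m * ε)) < (B - A / s) * Real.exp (-(m * s)) := by
  have hB : B = A / s + A / (m * s ^ 2) := by
    field_simp
    linear_combination hroot
  have hexp : m * (ε - s) + 1 < Real.exp (m * (ε - s)) :=
    Real.add_one_lt_exp (mul_ne_zero hm.ne' (sub_ne_zero.mpr hne))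
  have htangent : B - A / ε ≤ A / (m * s ^ 2) * (m * (ε - s) + 1) := by
    have hgap : A / (m * s ^ 2) * (m * (ε - s) + 1) - (B - A / ε) =
        A * (ε - s) ^ 2 / (s ^ 2 * ε) := by
      rw [hB]
      field_simp
      ring
    have : 0 ≤ A * (ε - s) ^ 2 / (s ^ 2 * ε) := by positivity
    linarith
  have hsplit : Real.exp (m * (ε - s)) * Real.exp (-(m * ε)) = Real.exp (-(m * s)) := by
    rw [← Real.exp_add]
    ring_nf
  calc (B - A / ε) * Real.exp (-(m * ε))
      < A / (m * s ^ 2) * Real.exp (m * (ε - s)) * Real.exp (-(m * ε)) := by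
        refine mul_lt_mul_of_pos_right (htangent.trans_lt ?_) (Real.exp_pos _)
        exact mul_lt_mul_of_pos_left hexp (by positivity)
    _ = (B - A / s) * Real.exp (-(m * s)) := by
        rw [mul_assoc, hsplit, hB]
        ring

/-- The AI operator's best response: given inspection intensity `m > 0`, the payoff
`π(ε; m) = u(ε) - (p + u(ε) - u(ε₀)) · (1 - exp(-m·ε))`, where `u(ε) = -G·η²/ε`,
attains its global maximum on `(0, ∞)` at the unique point `ε*(m)`. -/
theorem operator_best_response
    (G η p ε₀ m : ℝ) (hG : 0 < G) (hη : 0 < η) (hp : 0 < p) (hε₀ : 0 < ε₀)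
    (hm : 0 < m) :
    let u : ℝ → ℝ := fun ε => -(G * η ^ 2) / ε
    let π : ℝ → ℝ := fun ε => u ε - (p + u ε - u ε₀) * (1 - Real.exp (-(m * ε)))
    let εstar : ℝ :=
      (m * G * η ^ 2 * ε₀ +
          Real.sqrt (m ^ 2 * G ^ 2 * η ^ 4 * ε₀ ^ 2 +
            4 * G * η ^ 2 * m * (G * η ^ 2 * ε₀ + p * ε₀ ^ 2))) /
        (2 * m * (G * η ^ 2 + p * ε₀))
    (∀ ε : ℝ, 0 < ε → π ε ≤ π εstar) ∧
      (∀ ε : ℝ, 0 < ε → π ε = π εstar → ε = εstar) := by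
  intro u π εstar
  have hstar : 0 < εstar := by
    dsimp only [εstar]
    positivity
  have hroot : m * (p + G * η ^ 2 / ε₀) * εstar ^ 2 =
      m * (G * η ^ 2) * εstar + G * η ^ 2 := by
    dsimp only [εstar]
    set R := m ^ 2 * G ^ 2 * η ^ 4 * ε₀ ^ 2 +
      4 * G * η ^ 2 * m * (G * η ^ 2 * ε₀ + p * ε₀ ^ 2) with hR
    have hsq : Real.sqrt R ^ 2 = R := Real.sq_sqrt (by positivity)
    have hD : G * η ^ 2 + p * ε₀ ≠ 0 := by positivity
    field_simp
    linear_combination (G * η ^ 2 + p * ε₀) * hsq + (G * η ^ 2 + p * ε₀) * hR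
  have hπ (ε : ℝ) : π ε = (p + G * η ^ 2 / ε₀ - G * η ^ 2 / ε) * Real.exp (-(m * ε)) -
      (p + G * η ^ 2 / ε₀) := by
    dsimp only [π, u]
    ring
  have hlt (ε : ℝ) (hε : 0 < ε) (hne : ε ≠ εstar) : π ε < π εstar := by
    rw [hπ, hπ]
    exact sub_lt_sub_right
      (sub_div_mul_exp_neg_lt (by positivity) hm hstar hroot hε hne) _
  refine ⟨fun ε hε => ?_, fun ε hε heq => ?_⟩
  · rcases eq_or_ne ε εstar with h | h
    · rw [h]
    · exact (hlt ε hε h).le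
  · by_contra h
    exact (hlt ε hε h).ne heq
end

section
/- The function m ↦ ε*(m) = (m·G·η²·ε₀ + sqrt(m²·G²·η⁴·ε₀² + 4·G·η²·m·(G·η²·ε₀ + p·ε₀²))) / (2·m·(G·η² + p·ε₀)) is strictly decreasing on (0, ∞). -/
/-- Scaling out `m` turns the positive root `(m * a + √(m² * A + m * B)) / (2 * m * c)` into an
expression in which `m` occurs only through `B / m`. -/
theorem div_two_mul_sqrt_eq_sqrt_add_div {m : ℝ} (hm : 0 < m) (a A B c : ℝ) :
    (m * a + Real.sqrt (m ^ 2 * A + m * B)) / (2 * m * c) =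
      (a + Real.sqrt (A + B / m)) / (2 * c) := by
  have hs : Real.sqrt (m ^ 2 * A + m * B) = m * Real.sqrt (A + B / m) := by
    rw [show m ^ 2 * A + m * B = m ^ 2 * (A + B / m) by field_simp,
      Real.sqrt_mul (sq_nonneg m), Real.sqrt_sq hm.le]
  rw [hs, ← mul_add, show 2 * m * c = m * (2 * c) by ring, mul_div_mul_left _ _ hm.ne']

theorem strictAntiOn_add_sqrt_add_div {a A B c : ℝ} (hA : 0 ≤ A) (hB : 0 < B) (hc : 0 < c) :
    StrictAntiOn (fun m : ℝ => (a + Real.sqrt (A + B / m)) / (2 * c)) (Set.Ioi 0) := by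
  intro x hx y hy hxy
  have hx : 0 < x := hx
  have hy : 0 < y := hy
  have hdiv : B / y < B / x := div_lt_div_of_pos_left hB hx hxy
  have hsqrt : Real.sqrt (A + B / y) < Real.sqrt (A + B / x) :=
    Real.sqrt_lt_sqrt (by positivity) (by linarith)
  exact div_lt_div_of_pos_right (by linarith) (by positivity)

/-- The AI operator's best-response unlearning certification level `ε*(m)` is
strictly decreasing in the inspection intensity `m` on `(0, ∞)`. -/
theorem best_response_strictAnti
    (G η p ε₀ : ℝ) (hG : 0 < G) (hη : 0 < η) (hp : 0 < p) (hε₀ : 0 < ε₀) :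
    StrictAntiOn
      (fun m : ℝ =>
        (m * G * η ^ 2 * ε₀ +
            Real.sqrt (m ^ 2 * G ^ 2 * η ^ 4 * ε₀ ^ 2 +
              4 * G * η ^ 2 * m * (G * η ^ 2 * ε₀ + p * ε₀ ^ 2))) /
          (2 * m * (G * η ^ 2 + p * ε₀)))
      (Set.Ioi 0) := by
  refine (strictAntiOn_add_sqrt_add_div (a := G * η ^ 2 * ε₀) (A := G ^ 2 * η ^ 4 * ε₀ ^ 2)
    (B := 4 * G * η ^ 2 * (G * η ^ 2 * ε₀ + p * ε₀ ^ 2)) (c := G * η ^ 2 + p * ε₀)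
    (by positivity) (by positivity) (by positivity)).congr fun m hm => ?_
  dsimp only
  rw [← div_two_mul_sqrt_eq_sqrt_add_div hm]
  congr 2
  · ring
  · congr 1
    ring
end

section
/- The function m ↦ ε*(m) = (m·G·η²·ε₀ + sqrt(m²·G²·η⁴·ε₀² + 4·G·η²·m·(G·η²·ε₀ + p·ε₀²))) / (2·m·(G·η² + p·ε₀)) is convex on (0, ∞). -/
/-- The function `x ↦ √(a + b / x)` is convex on `(0, ∞)`: it is the Euclidean norm of the
vector `(√a, √b / √x)`, whose coordinates are nonnegative and convex. -/
theorem convexOn_sqrt_add_div {a b : ℝ} (ha : 0 ≤ a) (hb : 0 ≤ b) :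
    ConvexOn ℝ (Set.Ioi 0) (fun x : ℝ => Real.sqrt (a + b / x)) := by
  refine ⟨convex_Ioi 0, fun x hx y hy s t hs ht hst => ?_⟩
  rw [Set.mem_Ioi] at hx hy
  simp only [smul_eq_mul]
  obtain ⟨r, hr, rfl⟩ : ∃ r : ℝ, 0 < r ∧ r ^ 2 = x :=
    ⟨Real.sqrt x, Real.sqrt_pos.2 hx, Real.sq_sqrt hx.le⟩
  obtain ⟨q, hq, rfl⟩ : ∃ q : ℝ, 0 < q ∧ q ^ 2 = y :=
    ⟨Real.sqrt y, Real.sqrt_pos.2 hy, Real.sq_sqrt hy.le⟩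
  have hm : 0 < s * r ^ 2 + t * q ^ 2 := (convex_Ioi (0 : ℝ)) hx hy hs ht hst
  obtain rfl : t = 1 - s := by linarith
  have h_jensen : (s * r + (1 - s) * q) ^ 2 ≤ s * r ^ 2 + (1 - s) * q ^ 2 := by
    nlinarith [mul_nonneg (mul_nonneg hs ht) (sq_nonneg (r - q))]
  have h_prod : r * q ≤ (s * q + (1 - s) * r) * (s * r + (1 - s) * q) := by
    nlinarith [mul_nonneg (mul_nonneg hs ht) (sq_nonneg (r - q))]
  have h_inv : 1 / (s * r ^ 2 + (1 - s) * q ^ 2) ≤ (s / r + (1 - s) / q) ^ 2 := by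
    have h_eq : s / r + (1 - s) / q = (s * q + (1 - s) * r) / (r * q) := by
      field_simp
    rw [h_eq, div_pow, div_le_div_iff₀ hm (by positivity), one_mul]
    calc (r * q) ^ 2 ≤ ((s * q + (1 - s) * r) * (s * r + (1 - s) * q)) ^ 2 := by gcongr
      _ = (s * q + (1 - s) * r) ^ 2 * (s * r + (1 - s) * q) ^ 2 := mul_pow _ _ _
      _ ≤ _ := by gcongr
  have hu := Real.sq_sqrt (show 0 ≤ a + b / r ^ 2 by positivity)
  have hv := Real.sq_sqrt (show 0 ≤ a + b / q ^ 2 by positivity)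
  have h_cauchy : a + b / (r * q) ≤ √(a + b / r ^ 2) * √(a + b / q ^ 2) := by
    rw [← Real.sqrt_mul (by positivity)]
    apply Real.le_sqrt_of_sq_le
    have h_diff : (a + b / r ^ 2) * (a + b / q ^ 2) - (a + b / (r * q)) ^ 2 =
        a * b * (1 / r - 1 / q) ^ 2 := by
      field_simp
      ring
    nlinarith [mul_nonneg (mul_nonneg ha hb) (sq_nonneg (1 / r - 1 / q))]
  apply Real.sqrt_le_iff.2 ⟨by positivity, ?_⟩
  calc a + b / (s * r ^ 2 + (1 - s) * q ^ 2)
      = a + b * (1 / (s * r ^ 2 + (1 - s) * q ^ 2)) := by rw [mul_one_div]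
    _ ≤ a + b * (s / r + (1 - s) / q) ^ 2 := by gcongr
    _ = s ^ 2 * (a + b / r ^ 2) + 2 * (s * (1 - s)) * (a + b / (r * q)) +
        (1 - s) ^ 2 * (a + b / q ^ 2) := by
      field_simp
      ring
    _ ≤ s ^ 2 * (a + b / r ^ 2) +
        2 * (s * (1 - s)) * (√(a + b / r ^ 2) * √(a + b / q ^ 2)) +
        (1 - s) ^ 2 * (a + b / q ^ 2) := by
      have := mul_nonneg hs ht
      gcongr
    _ = (s * √(a + b / r ^ 2) + (1 - s) * √(a + b / q ^ 2)) ^ 2 := by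
      linear_combination (-s ^ 2) * hu - (1 - s) ^ 2 * hv

/-- The AI operator's best-response unlearning certification level `ε*(m)` is
convex in the inspection intensity `m` on `(0, ∞)`. -/
theorem best_response_convex
    (G η p ε₀ : ℝ) (hG : 0 < G) (hη : 0 < η) (hp : 0 < p) (hε₀ : 0 < ε₀) :
    ConvexOn ℝ (Set.Ioi 0)
      (fun m : ℝ =>
        (m * G * η ^ 2 * ε₀ +
            Real.sqrt (m ^ 2 * G ^ 2 * η ^ 4 * ε₀ ^ 2 +
              4 * G * η ^ 2 * m * (G * η ^ 2 * ε₀ + p * ε₀ ^ 2))) /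
          (2 * m * (G * η ^ 2 + p * ε₀))) := by
  have hK : 0 < G * η ^ 2 + p * ε₀ := by positivity
  have h_convex := ((convexOn_sqrt_add_div (a := (G * η ^ 2 * ε₀) ^ 2)
    (b := 4 * G * η ^ 2 * (G * η ^ 2 * ε₀ + p * ε₀ ^ 2)) (by positivity) (by positivity)).add_const
      (G * η ^ 2 * ε₀)).smul (show 0 ≤ 1 / (2 * (G * η ^ 2 + p * ε₀)) by positivity)
  refine h_convex.congr fun m hm => ?_
  rw [Set.mem_Ioi] at hm
  have h_sqrt : √(m ^ 2 * G ^ 2 * η ^ 4 * ε₀ ^ 2 +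
      4 * G * η ^ 2 * m * (G * η ^ 2 * ε₀ + p * ε₀ ^ 2)) =
      m * √((G * η ^ 2 * ε₀) ^ 2 + 4 * G * η ^ 2 * (G * η ^ 2 * ε₀ + p * ε₀ ^ 2) / m) := by
    rw [← Real.sqrt_sq hm.le, ← Real.sqrt_mul (sq_nonneg _), Real.sqrt_sq hm.le]
    congr 1
    field_simp
  simp only [Pi.add_apply, smul_eq_mul, h_sqrt]
  generalize √((G * η ^ 2 * ε₀) ^ 2 +
    4 * G * η ^ 2 * (G * η ^ 2 * ε₀ + p * ε₀ ^ 2) / m) = w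
  field_simp
  ring
end

section
/- Fix m > 0 and regard the best-response certification level as a function of the non-compliance fine: ε*(m; p) = (m·G·η²·ε₀ + sqrt(m²·G²·η⁴·ε₀² + 4·G·η²·m·(G·η²·ε₀ + p·ε₀²))) / (2·m·(G·η² + p·ε₀)). Then p ↦ ε*(m; p) is strictly decreasing on (0, ∞). -/
/-- The function `x ↦ (c + √(c² + k x)) / (a x)` is strictly decreasing on the positive reals. -/
theorem strictAntiOn_add_sqrt_div {a c k : ℝ} (ha : 0 < a) (hc : 0 < c) (hk : 0 < k) :
    StrictAntiOn (fun x : ℝ => (c + Real.sqrt (c ^ 2 + k * x)) / (a * x)) (Set.Ioi 0) := by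
  intro x hx y hy hxy
  simp only [Set.mem_Ioi] at hx hy
  have hsqrt : Real.sqrt (c ^ 2 + k * y) * x ≤ Real.sqrt (c ^ 2 + k * x) * y := by
    refine (pow_le_pow_iff_left₀ (by positivity) (by positivity) two_ne_zero).1 ?_
    rw [mul_pow, mul_pow, Real.sq_sqrt (by positivity), Real.sq_sqrt (by positivity)]
    have h₁ : c ^ 2 * x ^ 2 ≤ c ^ 2 * y ^ 2 := by gcongr
    have h₂ : k * x * y * x ≤ k * x * y * y := by gcongr
    linarith
  have hlin : c * x < c * y := by gcongr
  have hsum : (c + Real.sqrt (c ^ 2 + k * y)) * x < (c + Real.sqrt (c ^ 2 + k * x)) * y := by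
    linarith
  change _ / _ < _ / _
  rw [div_lt_div_iff₀ (by positivity) (by positivity)]
  linarith [mul_lt_mul_of_pos_left hsum ha]

/-- Given a fixed inspection intensity `m > 0`, the AI operator's best-response
unlearning certification level `ε*(m; p)` is strictly decreasing in the
non-compliance fine `p` on `(0, ∞)`. -/
theorem best_response_strictAnti_in_fine
    (G η ε₀ m : ℝ) (hG : 0 < G) (hη : 0 < η) (hε₀ : 0 < ε₀) (hm : 0 < m) :
    StrictAntiOn
      (fun p : ℝ =>
        (m * G * η ^ 2 * ε₀ +
            Real.sqrt (m ^ 2 * G ^ 2 * η ^ 4 * ε₀ ^ 2 +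
              4 * G * η ^ 2 * m * (G * η ^ 2 * ε₀ + p * ε₀ ^ 2))) /
          (2 * m * (G * η ^ 2 + p * ε₀)))
      (Set.Ioi 0) := by
  intro p hp q hq hpq
  simp only [Set.mem_Ioi] at hp hq
  have hanti := strictAntiOn_add_sqrt_div (a := 2 * m) (c := m * G * η ^ 2 * ε₀)
    (k := 4 * G * η ^ 2 * m * ε₀) (by positivity) (by positivity) (by positivity)
  have hlt : G * η ^ 2 + p * ε₀ < G * η ^ 2 + q * ε₀ := by gcongr
  have h := hanti (Set.mem_Ioi.2 (by positivity)) (Set.mem_Ioi.2 (by positivity)) hlt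
  convert h using 4 <;> ring_nf
end

section
/- Fix m > 0 and regard the best-response certification level as a function of the non-compliance fine: ε*(m; p) = (m·G·η²·ε₀ + sqrt(m²·G²·η⁴·ε₀² + 4·G·η²·m·(G·η²·ε₀ + p·ε₀²))) / (2·m·(G·η² + p·ε₀)). Then p ↦ ε*(m; p) is convex on (0, ∞). -/
/-- The reciprocal of a positive concave function is convex. -/
theorem ConcaveOn.convexOn_inv_of_pos {s : Set ℝ} {g : ℝ → ℝ} (hg : ConcaveOn ℝ s g)
    (hpos : ∀ x ∈ s, 0 < g x) : ConvexOn ℝ s (fun x => (g x)⁻¹) := by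
  refine ⟨hg.1, fun x hx y hy a b ha hb hab => ?_⟩
  have hx0 := hpos x hx
  have hy0 := hpos y hy
  have hmid : 0 < a • g x + b • g y := (convex_Ioi (0 : ℝ)) hx0 hy0 ha hb hab
  have hinv := (convexOn_zpow (𝕜 := ℝ) (-1)).2 hx0 hy0 ha hb hab
  simp only [zpow_neg_one] at hinv
  exact (inv_anti₀ hmid (hg.2 hx hy ha hb hab)).trans hinv

/-- The square root of an affine function is concave where that function is nonnegative. -/
theorem Real.concaveOn_sqrt_affine {s : Set ℝ} (hs : Convex ℝ s) (b c : ℝ)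
    (h : ∀ x ∈ s, 0 ≤ b + c * x) : ConcaveOn ℝ s (fun x => Real.sqrt (b + c * x)) := by
  refine ⟨hs, fun x hx y hy u v hu hv huv => ?_⟩
  have hsqrt := Real.strictConcaveOn_sqrt.concaveOn.2 (h x hx) (h y hy) hu hv huv
  convert hsqrt using 2
  simp only [smul_eq_mul]
  linear_combination (-b) * huv

/-- Rationalizing the larger root of `m t z² - a z - a / m = 0`. -/
theorem add_sqrt_div_eq_mul_inv {a t m : ℝ} (ha : 0 < a) (ht : 0 < t) (hm : 0 < m) :
    (a + Real.sqrt (a ^ 2 + 4 * a * t)) / (2 * m * t) =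
      2 * a / m * (Real.sqrt (a ^ 2 + 4 * a * t) - a)⁻¹ := by
  have hat : 0 < a * t := mul_pos ha ht
  have hlt : a < Real.sqrt (a ^ 2 + 4 * a * t) := Real.lt_sqrt_of_sq_lt (by linarith)
  have hsq := Real.sq_sqrt (show 0 ≤ a ^ 2 + 4 * a * t by positivity)
  generalize Real.sqrt (a ^ 2 + 4 * a * t) = r at hlt hsq ⊢
  have hne : r - a ≠ 0 := (sub_pos.2 hlt).ne'
  field_simp
  linear_combination hsq

/-- Given a fixed inspection intensity `m > 0`, the AI operator's best-response
unlearning certification level `ε*(m; p)` is convex in the non-compliance fine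
`p` on `(0, ∞)`. -/
theorem best_response_convex_in_fine
    (G η ε₀ m : ℝ) (hG : 0 < G) (hη : 0 < η) (hε₀ : 0 < ε₀) (hm : 0 < m) :
    ConvexOn ℝ (Set.Ioi 0)
      (fun p : ℝ =>
        (m * G * η ^ 2 * ε₀ +
            Real.sqrt (m ^ 2 * G ^ 2 * η ^ 4 * ε₀ ^ 2 +
              4 * G * η ^ 2 * m * (G * η ^ 2 * ε₀ + p * ε₀ ^ 2))) /
          (2 * m * (G * η ^ 2 + p * ε₀))) := by
  set a := m * (G * η ^ 2) * ε₀ with ha_def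
  have ha : 0 < a := by positivity
  have ht : ∀ p ∈ Set.Ioi (0 : ℝ), 0 < G * η ^ 2 + p * ε₀ := fun p hp => by
    have hp0 : 0 < p := hp
    positivity
  have hrad : ∀ p : ℝ, a ^ 2 + 4 * a * (G * η ^ 2) + 4 * a * ε₀ * p =
      a ^ 2 + 4 * a * (G * η ^ 2 + p * ε₀) := fun p => by ring
  have hconc : ConcaveOn ℝ (Set.Ioi 0)
      (fun p : ℝ => Real.sqrt (a ^ 2 + 4 * a * (G * η ^ 2) + 4 * a * ε₀ * p) - a) :=
    (Real.concaveOn_sqrt_affine (convex_Ioi 0) _ _ fun p hp => by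
      have hp0 : 0 < p := hp
      positivity).sub (convexOn_const a (convex_Ioi 0))
  have hpos : ∀ p ∈ Set.Ioi (0 : ℝ),
      0 < Real.sqrt (a ^ 2 + 4 * a * (G * η ^ 2) + 4 * a * ε₀ * p) - a := fun p hp => by
    refine sub_pos.2 (Real.lt_sqrt_of_sq_lt ?_)
    rw [hrad]
    linarith [mul_pos ha (ht p hp)]
  refine ((hconc.convexOn_inv_of_pos hpos).smul (c := 2 * a / m) (by positivity)).congr
    fun p hp => ?_
  have hroot := add_sqrt_div_eq_mul_inv ha (ht p hp) hm
  simp only [smul_eq_mul, hrad]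
  rw [← hroot, ha_def]
  ring_nf
end

section
/- There exists a unique real number ε* in the interval (c/p, ∞) satisfying the equation ((p + G·η²/ε₀)·ε* − G·η²)·ln(p·ε*/c) = G·η². -/
/-- For `A, K, p, c > 0`, the equation `(A x - K) log (p x / c) = K` has a unique solution
with `x > c / p`. -/
theorem existsUnique_affine_mul_log_eq {A K p c : ℝ} (hA : 0 < A) (hK : 0 < K) (hp : 0 < p)
    (hc : 0 < c) :
    ∃! x : ℝ, x ∈ Set.Ioi (c / p) ∧ (A * x - K) * Real.log (p * x / c) = K := by
  have hcp : 0 < c / p := div_pos hc hp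
  have log_pos : ∀ x, c / p < x → 0 < Real.log (p * x / c) := fun x hx ↦ by
    apply Real.log_pos
    rw [one_lt_div hc, mul_comm]
    exact (div_lt_iff₀ hp).1 hx
  have not_lt : ∀ x y, c / p < x → x < y → (A * x - K) * Real.log (p * x / c) = K →
      (A * y - K) * Real.log (p * y / c) ≠ K := fun x y hx hxy hfx hfy ↦ by
    have hlx := log_pos x hx
    have hax : 0 < A * x - K := pos_of_mul_pos_left (hK.trans_eq hfx.symm) hlx.le
    have hlog : Real.log (p * x / c) < Real.log (p * y / c) := by
      have hx0 : 0 < x := hcp.trans hx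
      apply Real.log_lt_log (by positivity)
      gcongr
    have haff : A * x - K < A * y - K := by gcongr
    exact (mul_lt_mul haff hlog.le hlx (hax.trans haff).le).ne (hfx.trans hfy.symm)
  obtain ⟨x, hx, hfx⟩ : ∃ x, c / p < x ∧ (A * x - K) * Real.log (p * x / c) = K := by
    set a := max (c / p) (K / A) with ha
    set b := 2 * K / A + c * Real.exp 1 / p with hb
    have hca : c / p ≤ a := le_max_left _ _
    have hfa : (A * a - K) * Real.log (p * a / c) = 0 := by
      rcases max_choice (c / p) (K / A) with h | h
      · rw [ha, h, mul_div_cancel₀ c hp.ne', div_self hc.ne', Real.log_one, mul_zero]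
      · rw [ha, h, mul_div_cancel₀ K hA.ne', sub_self, zero_mul]
    have hKA : 0 < K / A := div_pos hK hA
    have hbe : b = 2 * (K / A) + (c / p) * Real.exp 1 := by rw [hb]; ring
    have hexp : 1 ≤ Real.exp 1 := Real.one_le_exp zero_le_one
    have hab : a ≤ b := by
      apply max_le <;> nlinarith
    have hlog : 1 ≤ Real.log (p * b / c) := by
      have h : Real.exp 1 ≤ p * b / c := by
        rw [le_div_iff₀ hc]
        calc Real.exp 1 * c = p * (c / p * Real.exp 1) := by field_simp
          _ ≤ p * b := by gcongr; linarith
      exact (Real.le_log_iff_exp_le ((Real.exp_pos 1).trans_le h)).2 h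
    have haff : K ≤ A * b - K := by
      have h : A * (K / A) = K := mul_div_cancel₀ K hA.ne'
      have h' : 0 < A * (c / p * Real.exp 1) := by positivity
      rw [hbe, mul_add]
      linarith
    have hfb : K ≤ (A * b - K) * Real.log (p * b / c) := by nlinarith
    have hcont : ContinuousOn (fun x ↦ (A * x - K) * Real.log (p * x / c)) (Set.Icc a b) := by
      refine ContinuousOn.mul (by fun_prop) (ContinuousOn.log (by fun_prop) fun x hx ↦ ?_)
      have hx0 : 0 < x := hcp.trans_le (hca.trans hx.1)
      positivity
    obtain ⟨x, hx, hfx⟩ := intermediate_value_Icc hab hcont ⟨hfa.le.trans hK.le, hfb⟩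
    refine ⟨x, hca.trans_lt (lt_of_le_of_ne hx.1 ?_), hfx⟩
    rintro rfl
    exact hK.ne (hfa.symm.trans hfx)
  refine ⟨x, ⟨hx, hfx⟩, fun y ⟨hy, hfy⟩ ↦ ?_⟩
  rcases lt_trichotomy y x with h | h | h
  · exact absurd hfx (not_lt y x hy h hfy)
  · exact h
  · exact absurd hfy (not_lt x y hx h hfx)

/-- Existence and uniqueness of the equilibrium unlearning certification level:
there is a unique `ε* ∈ (c/p, ∞)` with
`((p + G·η²/ε₀)·ε* - G·η²)·ln(p·ε*/c) = G·η²`. -/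
theorem equilibrium_certification_exists_unique
    (G η p ε₀ c : ℝ) (hG : 0 < G) (hη : 0 < η) (hp : 0 < p) (hε₀ : 0 < ε₀)
    (hc : 0 < c) :
    ∃! ε : ℝ, ε ∈ Set.Ioi (c / p) ∧
      ((p + G * η ^ 2 / ε₀) * ε - G * η ^ 2) * Real.log (p * ε / c)
        = G * η ^ 2 := by
  exact existsUnique_affine_mul_log_eq (by positivity) (by positivity) hp hc
end

section
/- Let ε* be the unique solution in (c/p, ∞) of ((p + G·η²/ε₀)·ε* − G·η²)·ln(p·ε*/c) = G·η², and set m* = (1/ε*)·ln(p·ε*/c). Then m* > 0, π(ε*; m*) ≥ π(ε; m*) for every ε > 0, and Π_c(m*; ε*) ≥ Π_c(m; ε*) for every m ≥ 0; that is, (ε*, m*) is a Nash equilibrium of the MU compliance auditing game. -/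
/-- Nash equilibrium of the MU compliance auditing game: if `ε*` solves the
equilibrium equation on `(c/p, ∞)` and `m* = (1/ε*)·ln(p·ε*/c)`, then `m* > 0`,
`ε*` maximizes the AI operator's payoff given `m*`, and `m*` maximizes the
auditor's regulatory surplus given `ε*`. -/
theorem equilibrium_is_nash
    (G η p ε₀ c : ℝ) (hG : 0 < G) (hη : 0 < η) (hp : 0 < p) (hε₀ : 0 < ε₀)
    (hc : 0 < c)
    (εstar : ℝ) (hεstar : εstar ∈ Set.Ioi (c / p))
    (heq : ((p + G * η ^ 2 / ε₀) * εstar - G * η ^ 2) *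
        Real.log (p * εstar / c) = G * η ^ 2) :
    let u : ℝ → ℝ := fun ε => -(G * η ^ 2) / ε
    let π : ℝ → ℝ → ℝ := fun ε m =>
      u ε - (p + u ε - u ε₀) * (1 - Real.exp (-(m * ε)))
    let Pc : ℝ → ℝ → ℝ := fun m ε => p * (1 - Real.exp (-(m * ε))) - m * c
    let mstar : ℝ := (1 / εstar) * Real.log (p * εstar / c)
    0 < mstar ∧
      (∀ ε : ℝ, 0 < ε → π ε mstar ≤ π εstar mstar) ∧
      (∀ m : ℝ, 0 ≤ m → Pc m εstar ≤ Pc mstar εstar) := by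
  intro u π Pc mstar
  have hs : 0 < εstar := (div_pos hc hp).trans hεstar
  have hratio : 1 < p * εstar / c := by
    have h : c < εstar * p := (div_lt_iff₀ hp).mp hεstar
    rw [lt_div_iff₀ hc]
    linarith
  have hL : 0 < Real.log (p * εstar / c) := Real.log_pos hratio
  have hA : 0 < G * η ^ 2 := by positivity
  have hm : 0 < mstar := mul_pos (by positivity) hL
  have hmL : Real.log (p * εstar / c) = mstar * εstar := by
    simp only [mstar]
    field_simp
  clear_value mstar
  refine ⟨hm, fun ε hε => ?_, fun m _ => ?_⟩
  · have hπ : ∀ x, π x mstar = (p + G * η ^ 2 / ε₀ - G * η ^ 2 / x) *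
        Real.exp (-(mstar * x)) - (p + G * η ^ 2 / ε₀) := by
      intro x
      simp only [π, u]
      ring
    rw [hπ, hπ]
    rw [hmL] at heq hL
    generalize p + G * η ^ 2 / ε₀ = q at heq ⊢
    generalize G * η ^ 2 = A at heq hA ⊢
    have hmargin : 0 < q * εstar - A := pos_of_mul_pos_left (hA.trans_eq heq.symm) hL.le
    have hfoc : (q - A / εstar) * mstar = A / εstar ^ 2 := by
      field_simp
      linarith
    have hpos : 0 ≤ q - A / εstar := by
      rw [sub_nonneg, div_le_iff₀ hs]
      linarith
    have htangent : q - A / ε ≤ (q - A / εstar) + A / εstar ^ 2 * (ε - εstar) := by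
      have hgap : (q - A / εstar) + A / εstar ^ 2 * (ε - εstar) - (q - A / ε) =
          A * (ε - εstar) ^ 2 / (εstar ^ 2 * ε) := by
        field_simp
        ring
      have : 0 ≤ A * (ε - εstar) ^ 2 / (εstar ^ 2 * ε) := by positivity
      linarith
    have hexp : q - A / ε ≤ (q - A / εstar) * Real.exp (mstar * (ε - εstar)) :=
      calc q - A / ε ≤ (q - A / εstar) * (mstar * (ε - εstar) + 1) := by
            rw [← hfoc] at htangent
            linarith
        _ ≤ _ := mul_le_mul_of_nonneg_left (Real.add_one_le_exp _) hpos
    have hprod := mul_le_mul_of_nonneg_right hexp (Real.exp_pos (-(mstar * ε))).le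
    rw [mul_assoc, ← Real.exp_add,
      show mstar * (ε - εstar) + -(mstar * ε) = -(mstar * εstar) by ring] at hprod
    linarith
  · have hopt : Real.exp (-(mstar * εstar)) = c / (p * εstar) := by
      rw [← hmL, Real.exp_neg, Real.exp_log (by positivity), inv_div]
    have hexp : c / (p * εstar) * ((mstar - m) * εstar + 1) ≤ Real.exp (-(m * εstar)) := by
      calc _ ≤ c / (p * εstar) * Real.exp ((mstar - m) * εstar) :=
            mul_le_mul_of_nonneg_left (Real.add_one_le_exp _) (by positivity)
        _ = _ := by
            rw [← hopt, ← Real.exp_add]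
            ring_nf
    have hscaled := mul_le_mul_of_nonneg_left hexp hp.le
    have hexpand : p * (c / (p * εstar) * ((mstar - m) * εstar + 1)) =
        (mstar - m) * c + p * (c / (p * εstar)) := by
      field_simp
    simp only [Pc]
    rw [hopt]
    linarith
end

section
/- Suppose ε̂ ∈ (0, ∞) and m̂ ∈ [0, ∞) satisfy π(ε̂; m̂) ≥ π(ε; m̂) for every ε > 0 and Π_c(m̂; ε̂) ≥ Π_c(m; ε̂) for every m ≥ 0 (i.e. (ε̂, m̂) is a Nash equilibrium). Then ε̂ = ε* and m̂ = m*, where ε* is the unique solution in (c/p, ∞) of ((p + G·η²/ε₀)·ε* − G·η²)·ln(p·ε*/c) = G·η² and m* = (1/ε*)·ln(p·ε*/c). In particular, the Nash equilibrium of the MU compliance auditing game is unique. -/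
/-- On `(c / p, ∞)` the equation `(A * x - K) * log (p * x / c) = K` has at most one solution. -/
theorem equilibrium_equation_unique {A K p c : ℝ} (hA : 0 < A) (hK : 0 < K) (hp : 0 < p)
    (hc : 0 < c) {x y : ℝ} (hx : c / p < x) (hy : c / p < y)
    (ex : (A * x - K) * Real.log (p * x / c) = K)
    (ey : (A * y - K) * Real.log (p * y / c) = K) : x = y := by
  have key : ∀ a b : ℝ, c / p < a → a < b → (A * a - K) * Real.log (p * a / c) = K →
      (A * b - K) * Real.log (p * b / c) = K → False := by
    intro a b ha hab ea eb
    have hpa : c < p * a := by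
      have := (div_lt_iff₀ hp).1 ha
      linarith
    have hla : 0 < Real.log (p * a / c) := Real.log_pos ((one_lt_div hc).2 hpa)
    have hlog : Real.log (p * a / c) < Real.log (p * b / c) := by
      apply Real.log_lt_log (div_pos (hc.trans hpa) hc)
      gcongr
    have hposa : 0 < A * a - K := pos_of_mul_pos_left (by rwa [ea]) hla.le
    have hAab : A * a < A * b := by gcongr
    have := mul_lt_mul'' (sub_lt_sub_right hAab K) hlog hposa.le hla.le
    linarith
  rcases lt_trichotomy x y with h | h | h
  · exact (key x y hx h ex ey).elim
  · exact h
  · exact (key y x hy h ey ex).elim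

/-- First-order condition for a maximizer of `(A - K / x) * exp (-(m * x))` on `(0, ∞)`. -/
theorem operator_first_order {A K m x : ℝ} (hx : 0 < x)
    (h : ∀ y : ℝ, 0 < y →
      (A - K / y) * Real.exp (-(m * y)) ≤ (A - K / x) * Real.exp (-(m * x))) :
    (A * x - K) * (m * x) = K := by
  have hmax : IsLocalMax (fun y : ℝ => (A - K * y⁻¹) * Real.exp (-(m * y))) x := by
    filter_upwards [lt_mem_nhds hx] with y hy
    simpa only [div_eq_mul_inv] using h y hy
  have hd := (((hasDerivAt_inv hx.ne').const_mul K).const_sub A).mul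
    ((((hasDerivAt_id x).const_mul m).neg).exp)
  have h0 := hmax.hasDerivAt_eq_zero hd
  simp only [id, Pi.neg_apply] at h0
  have he := Real.exp_pos (-(m * x))
  have h1 : Real.exp (-(m * x)) * (K - (A * x - K) * (m * x)) = 0 := by
    field_simp at h0
    rw [mul_comm m x]
    linear_combination h0
  rcases mul_eq_zero.1 h1 with h2 | h2
  · exact absurd h2 he.ne'
  · linarith

/-- First-order condition for an interior maximizer of the regulatory surplus. -/
theorem auditor_first_order {p c x m : ℝ} (hm : 0 < m)
    (h : ∀ n : ℝ, 0 ≤ n →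
      p * (1 - Real.exp (-(n * x))) - n * c ≤ p * (1 - Real.exp (-(m * x))) - m * c) :
    p * x * Real.exp (-(m * x)) = c := by
  have hmax : IsLocalMax (fun n : ℝ => p * (1 - Real.exp (-(n * x))) - n * c) m := by
    filter_upwards [lt_mem_nhds hm] with n hn
    exact h n hn.le
  have hd := ((((((hasDerivAt_id m).mul_const x).neg).exp).const_sub 1).const_mul p).sub
    ((hasDerivAt_id m).mul_const c)
  have h0 := hmax.hasDerivAt_eq_zero hd
  simp only [id, Pi.neg_apply] at h0
  linear_combination h0

/-- Uniqueness of the Nash equilibrium: any Nash equilibrium `(ε̂, m̂)` of the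
MU compliance auditing game coincides with `(ε*, m*)`, where `ε*` is the unique
solution in `(c/p, ∞)` of the equilibrium equation and
`m* = (1/ε*)·ln(p·ε*/c)`. -/
theorem nash_equilibrium_unique
    (G η p ε₀ c : ℝ) (hG : 0 < G) (hη : 0 < η) (hp : 0 < p) (hε₀ : 0 < ε₀)
    (hc : 0 < c)
    (εstar : ℝ) (hεstar : εstar ∈ Set.Ioi (c / p))
    (heq : ((p + G * η ^ 2 / ε₀) * εstar - G * η ^ 2) *
        Real.log (p * εstar / c) = G * η ^ 2)
    (εhat mhat : ℝ) (hεhat : 0 < εhat) (hmhat : 0 ≤ mhat)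
    (hNE₁ : ∀ ε : ℝ, 0 < ε →
      (-(G * η ^ 2) / ε -
          (p + -(G * η ^ 2) / ε - -(G * η ^ 2) / ε₀) *
            (1 - Real.exp (-(mhat * ε))))
        ≤ (-(G * η ^ 2) / εhat -
          (p + -(G * η ^ 2) / εhat - -(G * η ^ 2) / ε₀) *
            (1 - Real.exp (-(mhat * εhat)))))
    (hNE₂ : ∀ m : ℝ, 0 ≤ m →
      p * (1 - Real.exp (-(m * εhat))) - m * c
        ≤ p * (1 - Real.exp (-(mhat * εhat))) - mhat * c) :
    εhat = εstar ∧ mhat = (1 / εstar) * Real.log (p * εstar / c) := by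
  have hK : 0 < G * η ^ 2 := by positivity
  set K := G * η ^ 2
  have hA : 0 < p + K / ε₀ := by positivity
  set A := p + K / ε₀ with hAdef
  have hfoc : (A * εhat - K) * (mhat * εhat) = K := by
    refine operator_first_order hεhat fun y hy => ?_
    have := hNE₁ y hy
    rw [hAdef]
    simp only [neg_div] at this
    linarith
  have hm : 0 < mhat := by
    refine lt_of_le_of_ne hmhat fun h => ?_
    rw [← h] at hfoc
    linarith
  have haud := auditor_first_order hm hNE₂
  have hexp : p * εhat / c = Real.exp (mhat * εhat) := by
    rw [div_eq_iff hc.ne', ← haud, Real.exp_neg]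
    field_simp
  have hlog : Real.log (p * εhat / c) = mhat * εhat := by
    rw [hexp, Real.log_exp]
  have hlarge : c / p < εhat := by
    have h1 : 1 < p * εhat / c := hexp ▸ Real.one_lt_exp_iff.2 (mul_pos hm hεhat)
    rw [div_lt_iff₀ hp, mul_comm]
    exact (one_lt_div hc).1 h1
  have heps : εhat = εstar :=
    equilibrium_equation_unique hA hK hp hc hlarge hεstar (hlog.symm ▸ hfoc) heq
  refine ⟨heps, ?_⟩
  rw [← heps, hlog]
  field_simp
end

section
/- For each η > 0, let ε*(η) denote the unique solution in (c/p, ∞) of ((p + G·η²/ε₀)·ε − G·η²)·ln(p·ε/c) = G·η². Then ε*(η) is strictly increasing in η: for all 0 < η₁ < η₂, ε*(η₁) < ε*(η₂). -/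
/-- The equilibrium unlearning certification level `ε*(η)` is strictly
increasing in the unlearning data proportion `η`: if `ε₁` and `ε₂` are the
equilibrium solutions for `0 < η₁ < η₂`, then `ε₁ < ε₂`. -/
theorem equilibrium_certification_strictMono_in_eta
    (G p ε₀ c : ℝ) (hG : 0 < G) (hp : 0 < p) (hε₀ : 0 < ε₀) (hc : 0 < c)
    (η₁ η₂ ε₁ ε₂ : ℝ) (hη₁ : 0 < η₁) (hη₁₂ : η₁ < η₂)
    (hε₁ : ε₁ ∈ Set.Ioi (c / p))
    (heq₁ : ((p + G * η₁ ^ 2 / ε₀) * ε₁ - G * η₁ ^ 2) *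
        Real.log (p * ε₁ / c) = G * η₁ ^ 2)
    (hε₂ : ε₂ ∈ Set.Ioi (c / p))
    (heq₂ : ((p + G * η₂ ^ 2 / ε₀) * ε₂ - G * η₂ ^ 2) *
        Real.log (p * ε₂ / c) = G * η₂ ^ 2) :
    ε₁ < ε₂ := by
  have one_lt {ε : ℝ} (h : ε ∈ Set.Ioi (c / p)) : 1 < p * ε / c := by
    rw [one_lt_div hc, mul_comm]
    exact (div_lt_iff₀ hp).1 h
  have hL₁ : 0 < Real.log (p * ε₁ / c) := Real.log_pos (one_lt hε₁)
  have hL₂ : 0 < Real.log (p * ε₂ / c) := Real.log_pos (one_lt hε₂)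
  have hpos : 0 < ε₂ := (div_pos hc hp).trans hε₂
  have hg : G * η₁ ^ 2 < G * η₂ ^ 2 := by gcongr
  have hg₁ : 0 < G * η₁ ^ 2 := by positivity
  have balance {g ε L : ℝ} (hL : 0 < L) (h : ((p + g / ε₀) * ε - g) * L = g) :
      p * ε = g * (1 / L + 1 - ε / ε₀) := by
    have h' : (p + g / ε₀) * ε - g = g / L := (eq_div_iff hL.ne').2 h
    linear_combination h'
  have e₁ := balance hL₁ heq₁
  have e₂ := balance hL₂ heq₂
  by_contra! hle
  have hlog : Real.log (p * ε₂ / c) ≤ Real.log (p * ε₁ / c) :=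
    Real.log_le_log (by positivity) (by gcongr)
  have hfac : 1 / Real.log (p * ε₁ / c) + 1 - ε₁ / ε₀ ≤
      1 / Real.log (p * ε₂ / c) + 1 - ε₂ / ε₀ := by gcongr
  have hfac_pos : 0 < 1 / Real.log (p * ε₂ / c) + 1 - ε₂ / ε₀ :=
    pos_of_mul_pos_right (e₂ ▸ mul_pos hp hpos) (hg₁.trans hg).le
  have hlt : p * ε₁ < p * ε₂ := by
    rw [e₁, e₂]
    exact (mul_le_mul_of_nonneg_left hfac hg₁.le).trans_lt
      (mul_lt_mul_of_pos_right hg hfac_pos)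
  exact hle.not_gt (lt_of_mul_lt_mul_left hlt hp.le)
end

section
/- Assume 2·G·η_max² > e·c and p > p_th, where p_th = e·c·G·η_max² / ((2·G·η_max² − e·c)·ε₀) and e is the base of the natural logarithm. Define η_th(p) = sqrt(p·e·c·ε₀ / ((2·p·ε₀ − e·c)·G)); then 0 < η_th(p) < η_max. The equilibrium inspection intensity m*(η) = ln(p·ε*(η)/c)/ε*(η) is increasing in η on (0, η_th(p)] and decreasing in η on [η_th(p), η_max]. -/
/-- `log x / x` is increasing on `(0, e]`. -/
theorem log_div_self_monotoneOn_Ioc_exp_one :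
    MonotoneOn (fun x : ℝ => Real.log x / x) (Set.Ioc 0 (Real.exp 1)) := by
  rintro x ⟨hx, -⟩ y ⟨hy, hye⟩ hxy
  have hly : Real.log y ≤ 1 := by
    simpa using Real.log_le_log hy hye
  have hlog : Real.log x - Real.log y ≤ x / y - 1 := by
    rw [← Real.log_div hx.ne' hy.ne']
    exact Real.log_le_sub_one_of_pos (div_pos hx hy)
  have hmul : y * (Real.log x - Real.log y) ≤ x - y := by
    calc y * (Real.log x - Real.log y) ≤ y * (x / y - 1) := by gcongr
      _ = x - y := by field_simp
  simp only
  rw [div_le_div_iff₀ hx hy]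
  nlinarith [mul_nonneg (sub_nonneg.2 hxy) (sub_nonneg.2 hly)]

/-- `(1 + 1 / log x) / x` is strictly decreasing on `(1, ∞)`. -/
theorem strictAntiOn_one_add_inv_log_div_self :
    StrictAntiOn (fun x : ℝ => (1 + (Real.log x)⁻¹) / x) (Set.Ioi 1) := by
  intro x hx y hy hxy
  have hx0 : (0 : ℝ) < x := one_pos.trans hx
  have hlx : 0 < Real.log x := Real.log_pos hx
  have hly : 0 < Real.log y := Real.log_pos hy
  have hinv : (Real.log y)⁻¹ ≤ (Real.log x)⁻¹ :=
    inv_anti₀ hlx (Real.log_le_log hx0 hxy.le)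
  simp only
  exact div_lt_div₀' (by linarith) hxy (by positivity) hx0

/-- The equilibrium equation solved for the scale `A = G * η ^ 2`, in the
rescaled variable `x = p * ε / c`. -/
theorem one_add_inv_log_div_eq_of_equilibrium {A p ε₀ c ε : ℝ} (hA : 0 < A) (hp : 0 < p)
    (hε₀ : 0 < ε₀) (hc : 0 < c) (hε : c / p < ε)
    (h : ((p + A / ε₀) * ε - A) * Real.log (p * ε / c) = A) :
    1 < p * ε / c ∧
      (1 + (Real.log (p * ε / c))⁻¹) / (p * ε / c) = c / A + c / (p * ε₀) := by
  have hx : 1 < p * ε / c := by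
    rw [div_lt_iff₀ hp] at hε
    rw [lt_div_iff₀ hc]
    linarith
  refine ⟨hx, ?_⟩
  have hL : 0 < Real.log (p * ε / c) := Real.log_pos hx
  have hε0 : 0 < ε := (div_pos hc hp).trans hε
  generalize Real.log (p * ε / c) = L at h hL
  field_simp at h ⊢
  linarith


/-- High-fine regime: if `2·G·η_max² > e·c` and `p > p_th`, then
`0 < η_th(p) < η_max`, and the equilibrium inspection intensity
`m*(η) = ln(p·ε*(η)/c)/ε*(η)` increases in `η` on `(0, η_th(p)]` and decreases
in `η` on `[η_th(p), η_max]`. -/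
theorem inspection_intensity_high_fine_regime
    (G p ε₀ c ηmax : ℝ) (hG : 0 < G) (hp : 0 < p) (hε₀ : 0 < ε₀) (hc : 0 < c)
    (hηmax : ηmax ∈ Set.Ioc (0 : ℝ) 1)
    (hreg : 2 * G * ηmax ^ 2 > Real.exp 1 * c)
    (hpth : p > Real.exp 1 * c * G * ηmax ^ 2 /
        ((2 * G * ηmax ^ 2 - Real.exp 1 * c) * ε₀))
    (εstar : ℝ → ℝ)
    (hεstar : ∀ η : ℝ, 0 < η → εstar η ∈ Set.Ioi (c / p) ∧
      ((p + G * η ^ 2 / ε₀) * εstar η - G * η ^ 2) *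
          Real.log (p * εstar η / c) = G * η ^ 2) :
    let ηth : ℝ := Real.sqrt (p * Real.exp 1 * c * ε₀ /
      ((2 * p * ε₀ - Real.exp 1 * c) * G))
    let mstar : ℝ → ℝ := fun η => Real.log (p * εstar η / c) / εstar η
    (0 < ηth ∧ ηth < ηmax) ∧
      MonotoneOn mstar (Set.Ioc 0 ηth) ∧
      AntitoneOn mstar (Set.Icc ηth ηmax) := by
  intro ηth mstar
  have he : 0 < Real.exp 1 := Real.exp_pos 1
  have hηm : 0 < ηmax := hηmax.1
  have hkey : Real.exp 1 * c * G * ηmax ^ 2 <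
      p * ((2 * G * ηmax ^ 2 - Real.exp 1 * c) * ε₀) :=
    (div_lt_iff₀ (mul_pos (by linarith) hε₀)).1 hpth
  have hden : 0 < 2 * p * ε₀ - Real.exp 1 * c := by
    have h1 : 0 < Real.exp 1 * c * (p * ε₀) := by positivity
    have h2 : 0 < (2 * p * ε₀ - Real.exp 1 * c) * (G * ηmax ^ 2) := by nlinarith
    exact pos_of_mul_pos_left h2 (by positivity)
  have hth : 0 < ηth := Real.sqrt_pos.2 (by positivity)
  have hthsq : ηth ^ 2 = p * Real.exp 1 * c * ε₀ /
      ((2 * p * ε₀ - Real.exp 1 * c) * G) := Real.sq_sqrt (by positivity)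
  have hlt : ηth < ηmax := by
    refine lt_of_pow_lt_pow_left₀ 2 hηm.le ?_
    rw [hthsq, div_lt_iff₀ (by positivity)]
    nlinarith
  have hx (η : ℝ) (hη : 0 < η) : 1 < p * εstar η / c ∧
      (1 + (Real.log (p * εstar η / c))⁻¹) / (p * εstar η / c) =
        c / (G * η ^ 2) + c / (p * ε₀) :=
    one_add_inv_log_div_eq_of_equilibrium (by positivity) hp hε₀ hc (hεstar η hη).1
      (hεstar η hη).2
  have hmono {η η' : ℝ} (hη : 0 < η) (h : η ≤ η') :
      p * εstar η / c ≤ p * εstar η' / c := by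
    have hη' := hη.trans_le h
    rw [← strictAntiOn_one_add_inv_log_div_self.le_iff_ge (hx η' hη').1 (hx η hη).1]
    rw [(hx η hη).2, (hx η' hη').2]
    gcongr
  have hxth : p * εstar ηth / c = Real.exp 1 := by
    refine strictAntiOn_one_add_inv_log_div_self.injOn (hx ηth hth).1
      (Real.one_lt_exp_iff.2 one_pos) ?_
    rw [(hx ηth hth).2, hthsq, Real.log_exp]
    field_simp
    ring
  have hm (η : ℝ) (hη : 0 < η) :
      mstar η = p / c * (Real.log (p * εstar η / c) / (p * εstar η / c)) := by
    have hε : 0 < εstar η := (div_pos hc hp).trans (hεstar η hη).1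
    simp only [mstar]
    field_simp
  refine ⟨⟨hth, hlt⟩, ?_, ?_⟩
  · rintro η ⟨hη, hηth⟩ η' ⟨hη', hηth'⟩ h
    rw [hm η hη, hm η' hη']
    refine mul_le_mul_of_nonneg_left ?_ (by positivity)
    exact log_div_self_monotoneOn_Ioc_exp_one
      ⟨one_pos.trans (hx η hη).1, (hmono hη hηth).trans_eq hxth⟩
      ⟨one_pos.trans (hx η' hη').1, (hmono hη' hηth').trans_eq hxth⟩ (hmono hη h)
  · rintro η ⟨hηth, -⟩ η' ⟨hηth', -⟩ h
    have hη := hth.trans_le hηth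
    have hη' := hth.trans_le hηth'
    rw [hm η hη, hm η' hη']
    refine mul_le_mul_of_nonneg_left ?_ (by positivity)
    exact Real.log_div_self_antitoneOn (hxth.symm.trans_le (hmono hth hηth))
      (hxth.symm.trans_le (hmono hth hηth')) (hmono hη h)
end

section
/- Let γ₁ > 0 and γ₂ > 0. Define, for m > 0, ε^d(m) = (m·G·η²·ε₀ + sqrt(m²·G²·η⁴·ε₀² + 4·G·η²·m·(G·η²·ε₀ + p·ε₀²))) / (2·m·(G·η² + p·ε₀)) and Q(m) = γ₁·(p·(1 − exp(−m·ε^d(m))) − m·c) − γ₂·ε^d(m). Then there exists a unique m^d ∈ (0, ∞) at which the derivative of Q vanishes (Q'(m^d) = 0), and this m^d is the global maximizer of Q on (0, ∞): Q(m^d) ≥ Q(m) for all m > 0. -/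
/-- The positive root `t` of `t ^ 2 = b * m * (t + 1)`. -/
noncomputable def posRoot (b m : ℝ) : ℝ :=
  (b * m + Real.sqrt ((b * m) ^ 2 + 4 * (b * m))) / 2

/-- The payoff in terms of the exposure `t`. -/
noncomputable def exposurePayoff (A B C t : ℝ) : ℝ :=
  A * (1 - Real.exp (-t)) - B * (t ^ 2 / (t + 1)) - C * ((t + 1) / t)

/-- The derivative of `exposurePayoff`. -/
noncomputable def exposureSlope (A B C t : ℝ) : ℝ :=
  A * Real.exp (-t) - B * (1 - 1 / (t + 1) ^ 2) + C * (1 / t ^ 2)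

theorem posRoot_pos {b m : ℝ} (hb : 0 < b) (hm : 0 < m) : 0 < posRoot b m := by
  unfold posRoot
  positivity

theorem posRoot_sq {b m : ℝ} (hb : 0 < b) (hm : 0 < m) :
    posRoot b m ^ 2 = b * m * (posRoot b m + 1) := by
  have h := Real.sq_sqrt (show 0 ≤ (b * m) ^ 2 + 4 * (b * m) by positivity)
  unfold posRoot
  linear_combination h / 4

theorem eq_of_posRoot_eq {b m n : ℝ} (hb : 0 < b) (hm : 0 < m) (hn : 0 < n)
    (h : posRoot b m = posRoot b n) : m = n := by
  have h₁ := posRoot_sq hb hm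
  have h₂ := posRoot_sq hb hn
  have h₃ := posRoot_pos hb hn
  rw [h] at h₁
  have h₄ : b * (posRoot b n + 1) ≠ 0 := by positivity
  apply mul_left_cancel₀ h₄
  linarith

theorem posRoot_div {b t : ℝ} (hb : 0 < b) (ht : 0 < t) :
    posRoot b (t ^ 2 / (b * (t + 1))) = t := by
  have hm : 0 < t ^ 2 / (b * (t + 1)) := by positivity
  have h₁ := posRoot_sq hb hm
  have h₂ := posRoot_pos hb hm
  have h₃ : b * (t ^ 2 / (b * (t + 1))) = t ^ 2 / (t + 1) := by field_simp
  rw [h₃] at h₁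
  set s := posRoot b (t ^ 2 / (b * (t + 1)))
  field_simp at h₁
  have h₄ : (s - t) * (s * t + s + t) = 0 := by linear_combination h₁
  have h₅ : s * t + s + t ≠ 0 := by positivity
  linarith [(mul_eq_zero.mp h₄).resolve_right h₅]

theorem exists_pos_hasDerivAt_posRoot {b m : ℝ} (hb : 0 < b) (hm : 0 < m) :
    ∃ d : ℝ, 0 < d ∧ HasDerivAt (posRoot b) d m := by
  have hlin : HasDerivAt (fun x : ℝ => b * x) b m := by
    simpa using (hasDerivAt_id m).const_mul b
  have hpos : 0 < (b * m) ^ 2 + 4 * (b * m) := by positivity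
  have h := (hlin.add (((hlin.pow 2).add (hlin.const_mul 4)).sqrt hpos.ne')).div_const 2
  refine ⟨_, ?_, h⟩
  simp only [Pi.add_apply, Pi.pow_apply]
  positivity

theorem hasDerivAt_exposurePayoff (A B C : ℝ) {t : ℝ} (ht : 0 < t) :
    HasDerivAt (exposurePayoff A B C) (exposureSlope A B C t) t := by
  have h₁ : HasDerivAt (fun x : ℝ => x + 1) 1 t := (hasDerivAt_id t).add_const 1
  have h₂ := (((hasDerivAt_neg t).exp.const_sub 1).const_mul A)
  have h₃ := ((hasDerivAt_pow 2 t).fun_div h₁ (by positivity)).const_mul B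
  have h₄ := (h₁.fun_div (hasDerivAt_id' t) ht.ne').const_mul C
  refine ((h₂.fun_sub h₃).fun_sub h₄).congr_deriv ?_
  unfold exposureSlope
  field_simp
  ring

theorem one_div_sub_one_div_le {s t : ℝ} (hs : 0 < s) (ht : 0 < t) :
    1 / t - 1 / s ≤ 1 / t ^ 2 * (s - t) := by
  have h : 1 / t ^ 2 * (s - t) - (1 / t - 1 / s) = (s - t) ^ 2 / (s * t ^ 2) := by
    field_simp
  have : 0 ≤ (s - t) ^ 2 / (s * t ^ 2) := by positivity
  linarith

/-- The graph of `exposurePayoff` lies below its tangent lines. -/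
theorem exposurePayoff_le_tangent {A B C s t : ℝ} (hA : 0 ≤ A) (hB : 0 ≤ B) (hC : 0 ≤ C)
    (hs : 0 < s) (ht : 0 < t) :
    exposurePayoff A B C s ≤ exposurePayoff A B C t + exposureSlope A B C t * (s - t) := by
  have h₁ : Real.exp (-t) - Real.exp (-s) ≤ Real.exp (-t) * (s - t) := by
    have h := mul_le_mul_of_nonneg_left (Real.add_one_le_exp (t - s)) (Real.exp_pos (-t)).le
    rw [← Real.exp_add, show -t + (t - s) = -s by ring] at h
    linarith
  have h₂ := one_div_sub_one_div_le (add_pos hs one_pos) (add_pos ht one_pos)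
  have h₃ := one_div_sub_one_div_le hs ht
  have e₁ : ∀ x : ℝ, 0 < x → x ^ 2 / (x + 1) = x - 1 + 1 / (x + 1) := by
    intro x hx
    field_simp
    ring
  have e₂ : ∀ x : ℝ, 0 < x → (x + 1) / x = 1 + 1 / x := by
    intro x hx
    field_simp
  unfold exposurePayoff exposureSlope
  rw [e₁ s hs, e₁ t ht, e₂ s hs, e₂ t ht]
  linarith [mul_le_mul_of_nonneg_left h₁ hA, mul_le_mul_of_nonneg_left h₂ hB,
    mul_le_mul_of_nonneg_left h₃ hC]

theorem exposureSlope_strictAntiOn {A B C : ℝ} (hA : 0 < A) (hB : 0 < B) (hC : 0 < C) :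
    StrictAntiOn (exposureSlope A B C) (Set.Ioi 0) := by
  intro s hs t ht hst
  rw [Set.mem_Ioi] at hs ht
  have h₁ : A * Real.exp (-t) < A * Real.exp (-s) := by gcongr
  have h₂ : B * (1 / (t + 1) ^ 2) < B * (1 / (s + 1) ^ 2) := by gcongr
  have h₃ : C * (1 / t ^ 2) < C * (1 / s ^ 2) := by gcongr
  unfold exposureSlope
  linarith

theorem exists_exposureSlope_eq_zero {A B C : ℝ} (hA : 0 < A) (hB : 0 < B) (hC : 0 < C) :
    ∃ t : ℝ, 0 < t ∧ exposureSlope A B C t = 0 := by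
  obtain ⟨u, hu, hu'⟩ : ∃ u : ℝ, 0 < u ∧ 0 ≤ exposureSlope A B C u := by
    refine ⟨Real.sqrt (C / B), by positivity, ?_⟩
    unfold exposureSlope
    rw [Real.sq_sqrt (by positivity)]
    have h₁ : C * (1 / (C / B)) = B := by field_simp
    have h₂ : 0 ≤ A * Real.exp (-Real.sqrt (C / B)) := by positivity
    have h₃ : 0 ≤ B * (1 / (Real.sqrt (C / B) + 1) ^ 2) := by positivity
    linarith
  obtain ⟨v, hv, hv'⟩ : ∃ v : ℝ, 0 < v ∧ exposureSlope A B C v ≤ 0 := by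
    set v := 1 + 2 * (A + C) / B with hv
    have hv₁ : 1 ≤ v := le_add_of_nonneg_right (by positivity)
    have hv₀ : 0 < v := by linarith
    refine ⟨v, hv₀, ?_⟩
    have h₁ : Real.exp (-v) ≤ 1 / v := by
      rw [Real.exp_neg, ← one_div]
      exact one_div_le_one_div_of_le hv₀ (by linarith [Real.add_one_le_exp v])
    have h₂ : 1 / v ^ 2 ≤ 1 / v := one_div_le_one_div_of_le hv₀ (by nlinarith)
    have h₃ : 1 / (v + 1) ^ 2 ≤ 1 / 2 := one_div_le_one_div_of_le two_pos (by nlinarith)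
    have h₄ : (A + C) * (1 / v) ≤ B * (1 / 2) := by
      have : B * v = B + 2 * (A + C) := by
        rw [hv]
        field_simp
      rw [mul_one_div, div_le_iff₀ hv₀]
      linarith
    unfold exposureSlope
    linarith [mul_le_mul_of_nonneg_left h₁ hA.le, mul_le_mul_of_nonneg_left h₂ hC.le,
      mul_le_mul_of_nonneg_left h₃ hB.le]
  have hsub : Set.uIcc v u ⊆ Set.Ioi 0 := fun x hx => (lt_min hv hu).trans_le hx.1
  have hcont : ContinuousOn (exposureSlope A B C) (Set.uIcc v u) := by
    intro x hx
    have hx₀ : 0 < x := hsub hx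
    have hx₁ : (x + 1) ^ 2 ≠ 0 := by positivity
    have hx₂ : x ^ 2 ≠ 0 := by positivity
    apply ContinuousAt.continuousWithinAt
    unfold exposureSlope
    fun_prop (disch := assumption)
  obtain ⟨t, ht, ht'⟩ := intermediate_value_uIcc hcont (Set.mem_uIcc_of_le hv' hu')
  exact ⟨t, hsub ht, ht'⟩


/-- Disclosed-auditing (Stackelberg) equilibrium: the auditor's anticipated
payoff `Q(m) = γ₁·(p·(1 - exp(-m·ε^d(m))) - m·c) - γ₂·ε^d(m)` has a unique
stationary point `m^d ∈ (0, ∞)`, which is its global maximizer on `(0, ∞)`. -/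
theorem disclosed_auditing_equilibrium
    (G η p ε₀ c γ₁ γ₂ : ℝ) (hG : 0 < G) (hη : 0 < η) (hp : 0 < p)
    (hε₀ : 0 < ε₀) (hc : 0 < c) (hγ₁ : 0 < γ₁) (hγ₂ : 0 < γ₂) :
    let εd : ℝ → ℝ := fun m =>
      (m * G * η ^ 2 * ε₀ +
          Real.sqrt (m ^ 2 * G ^ 2 * η ^ 4 * ε₀ ^ 2 +
            4 * G * η ^ 2 * m * (G * η ^ 2 * ε₀ + p * ε₀ ^ 2))) /
        (2 * m * (G * η ^ 2 + p * ε₀))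
    let Q : ℝ → ℝ := fun m =>
      γ₁ * (p * (1 - Real.exp (-(m * εd m))) - m * c) - γ₂ * εd m
    ∃ md : ℝ, 0 < md ∧ deriv Q md = 0 ∧
      (∀ m : ℝ, 0 < m → deriv Q m = 0 → m = md) ∧
      (∀ m : ℝ, 0 < m → Q m ≤ Q md) := by
  intro εd Q
  have hK : 0 < G * η ^ 2 + p * ε₀ := by positivity
  obtain ⟨b, hb⟩ : ∃ b, b = G * η ^ 2 * ε₀ / (G * η ^ 2 + p * ε₀) := ⟨_, rfl⟩
  have hb₀ : 0 < b := hb ▸ by positivity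
  have hbK : b * (G * η ^ 2 + p * ε₀) = G * η ^ 2 * ε₀ := by
    rw [hb]
    field_simp
  have hε : ∀ m, 0 < m → m * εd m = posRoot b m := by
    intro m hm
    have hsq : m ^ 2 * G ^ 2 * η ^ 4 * ε₀ ^ 2 +
        4 * G * η ^ 2 * m * (G * η ^ 2 * ε₀ + p * ε₀ ^ 2) =
        (G * η ^ 2 + p * ε₀) ^ 2 * ((b * m) ^ 2 + 4 * (b * m)) := by
      linear_combination (-(m ^ 2 * (G * η ^ 2 * ε₀ + b * (G * η ^ 2 + p * ε₀))) -
        4 * m * (G * η ^ 2 + p * ε₀)) * hbK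
    have hlin : m * G * η ^ 2 * ε₀ = (G * η ^ 2 + p * ε₀) * (b * m) := by
      linear_combination -m * hbK
    simp only [εd, posRoot]
    rw [hsq, Real.sqrt_mul (by positivity), Real.sqrt_sq hK.le, hlin]
    field_simp
  have hQ : ∀ m, 0 < m → Q m =
      exposurePayoff (γ₁ * p) (γ₁ * c / b) (γ₂ * b) (posRoot b m) := by
    intro m hm
    have ht := posRoot_pos hb₀ hm
    have hsq := posRoot_sq hb₀ hm
    have h₁ : m = posRoot b m ^ 2 / (b * (posRoot b m + 1)) := by
      rw [hsq]
      field_simp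
    have h₂ : εd m = b * ((posRoot b m + 1) / posRoot b m) := by
      apply mul_left_cancel₀ hm.ne'
      rw [hε m hm]
      field_simp
      linear_combination hsq
    have h₃ : m * c = c / b * (posRoot b m ^ 2 / (posRoot b m + 1)) := by
      rw [hsq]
      field_simp
    simp only [Q, exposurePayoff]
    rw [hε m hm, h₃, h₂]
    ring
  have hA : 0 < γ₁ * p := by positivity
  have hB : 0 < γ₁ * c / b := by positivity
  have hC : 0 < γ₂ * b := by positivity
  have hderiv : ∀ m, 0 < m → ∃ d, 0 < d ∧ deriv Q m =
      exposureSlope (γ₁ * p) (γ₁ * c / b) (γ₂ * b) (posRoot b m) * d := by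
    intro m hm
    obtain ⟨d, hd, hroot⟩ := exists_pos_hasDerivAt_posRoot hb₀ hm
    have h := (hasDerivAt_exposurePayoff (γ₁ * p) (γ₁ * c / b) (γ₂ * b)
      (posRoot_pos hb₀ hm)).comp m hroot
    refine ⟨d, hd, (h.congr_of_eventuallyEq ?_).deriv⟩
    filter_upwards [lt_mem_nhds hm] with x hx using hQ x hx
  obtain ⟨t, ht, ht'⟩ := exists_exposureSlope_eq_zero hA hB hC
  have hmd : 0 < t ^ 2 / (b * (t + 1)) := by positivity
  have hroot := posRoot_div hb₀ ht
  refine ⟨t ^ 2 / (b * (t + 1)), hmd, ?_, ?_, ?_⟩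
  · obtain ⟨d, -, h⟩ := hderiv _ hmd
    rw [h, hroot, ht', zero_mul]
  · intro m hm h
    obtain ⟨d, hd, h'⟩ := hderiv m hm
    have hz := (mul_eq_zero.mp (h'.symm.trans h)).resolve_right hd.ne'
    apply eq_of_posRoot_eq hb₀ hm hmd
    rw [hroot]
    exact (exposureSlope_strictAntiOn hA hB hC).injOn (posRoot_pos hb₀ hm) ht
      (hz.trans ht'.symm)
  · intro m hm
    have h := exposurePayoff_le_tangent hA.le hB.le hC.le (posRoot_pos hb₀ hm) ht
    rw [ht', zero_mul, add_zero] at h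
    rwa [hQ m hm, hQ _ hmd, hroot]
end

section
/- Let γ₁ > 0 and γ₂ > 0. Let ε* be the unique solution in (c/p, ∞) of ((p + G·η²/ε₀)·ε* − G·η²)·ln(p·ε*/c) = G·η² and m* = (1/ε*)·ln(p·ε*/c) (the Nash equilibrium of the undisclosed-auditing game). Let m^d be the global maximizer over m > 0 of Q(m) = γ₁·(p·(1 − exp(−m·ε^d(m))) − m·c) − γ₂·ε^d(m), where ε^d(m) = (m·G·η²·ε₀ + sqrt(m²·G²·η⁴·ε₀² + 4·G·η²·m·(G·η²·ε₀ + p·ε₀²))) / (2·m·(G·η² + p·ε₀)). Then the auditor's payoff under disclosed auditing is at least her payoff under undisclosed auditing: γ₁·(p·(1 − exp(−m^d·ε^d(m^d))) − m^d·c) − γ₂·ε^d(m^d) ≥ γ₁·(p·(1 − exp(−m*·ε*)) − m*·c) − γ₂·ε*. -/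
/-- The operator's best response to `m` is the positive root of the quadratic
`m (A + p ε₀) x² - m A ε₀ x - A ε₀`, where `A = G η²`. -/
theorem bestResponse_eq_of_quadratic {G η p ε₀ m x : ℝ} (hG : 0 < G) (hp : 0 < p)
    (hε₀ : 0 < ε₀) (hm : 0 < m) (hx : 0 < x) (hη : 0 < η)
    (h : m * (G * η ^ 2 + p * ε₀) * x ^ 2 - m * G * η ^ 2 * ε₀ * x = G * η ^ 2 * ε₀) :
    (m * G * η ^ 2 * ε₀ +
          Real.sqrt (m ^ 2 * G ^ 2 * η ^ 4 * ε₀ ^ 2 +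
            4 * G * η ^ 2 * m * (G * η ^ 2 * ε₀ + p * ε₀ ^ 2))) /
        (2 * m * (G * η ^ 2 + p * ε₀)) = x := by
  have hroot : 0 < m * (G * η ^ 2 + p * ε₀) * x - m * G * η ^ 2 * ε₀ := by
    refine pos_of_mul_pos_left (b := x) ?_ hx.le
    have : 0 < G * η ^ 2 * ε₀ := by positivity
    linarith
  have hlin : 0 < m * (G * η ^ 2 + p * ε₀) * x := by positivity
  have hdisc : m ^ 2 * G ^ 2 * η ^ 4 * ε₀ ^ 2 +
      4 * G * η ^ 2 * m * (G * η ^ 2 * ε₀ + p * ε₀ ^ 2) =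
      (2 * m * (G * η ^ 2 + p * ε₀) * x - m * G * η ^ 2 * ε₀) ^ 2 := by
    linear_combination (-4 * m * (G * η ^ 2 + p * ε₀)) * h
  rw [hdisc, Real.sqrt_sq (by linarith), div_eq_iff (by positivity)]
  ring


/-- Auditing transparency: the auditor's total expected payoff under disclosed
auditing (committing to `m^d`, with the operator best-responding `ε^d(m^d)`) is
at least her payoff at the Nash equilibrium `(ε*, m*)` of the
undisclosed-auditing game. -/
theorem disclosed_auditing_dominates
    (G η p ε₀ c γ₁ γ₂ : ℝ) (hG : 0 < G) (hη : 0 < η) (hp : 0 < p)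
    (hε₀ : 0 < ε₀) (hc : 0 < c) (hγ₁ : 0 < γ₁) (hγ₂ : 0 < γ₂)
    (εstar : ℝ) (hεstar : εstar ∈ Set.Ioi (c / p))
    (heq : ((p + G * η ^ 2 / ε₀) * εstar - G * η ^ 2) *
        Real.log (p * εstar / c) = G * η ^ 2)
    (mstar : ℝ) (hmstar : mstar = (1 / εstar) * Real.log (p * εstar / c))
    (εd : ℝ → ℝ)
    (hεd : ∀ m : ℝ, εd m =
      (m * G * η ^ 2 * ε₀ +
          Real.sqrt (m ^ 2 * G ^ 2 * η ^ 4 * ε₀ ^ 2 +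
            4 * G * η ^ 2 * m * (G * η ^ 2 * ε₀ + p * ε₀ ^ 2))) /
        (2 * m * (G * η ^ 2 + p * ε₀)))
    (md : ℝ) (hmd : 0 < md)
    (hmax : ∀ m : ℝ, 0 < m →
      γ₁ * (p * (1 - Real.exp (-(m * εd m))) - m * c) - γ₂ * εd m ≤
        γ₁ * (p * (1 - Real.exp (-(md * εd md))) - md * c) - γ₂ * εd md) :
    γ₁ * (p * (1 - Real.exp (-(md * εd md))) - md * c) - γ₂ * εd md ≥
      γ₁ * (p * (1 - Real.exp (-(mstar * εstar))) - mstar * c) - γ₂ * εstar := by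
  have hpos : 0 < εstar := (div_pos hc hp).trans hεstar
  have hlog : 0 < Real.log (p * εstar / c) := by
    apply Real.log_pos
    rw [one_lt_div hc, mul_comm]
    exact (div_lt_iff₀ hp).1 hεstar
  have hm : 0 < mstar := by rw [hmstar]; positivity
  have hresponse : εd mstar = εstar := by
    rw [hεd]
    refine bestResponse_eq_of_quadratic hG hp hε₀ hm hpos hη ?_
    have hlog_eq : Real.log (p * εstar / c) = mstar * εstar := by
      rw [hmstar]; field_simp
    rw [hlog_eq] at heq
    field_simp at heq
    linear_combination heq
  simpa only [hresponse] using hmax mstar hm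
end
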